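/- Let x₁,…,x₅ be points in a metric space satisfying the CAT(0) comparison, with associated quadratic form W on ℝ⁴ (vertices v₁,…,v₄ the standard basis, v₅ = 0). Let L ⊆ ℝ⁴ be a 1-dimensional subspace with W(v) < 0 for all nonzero v ∈ L, and let π : ℝ⁴ → ℝ³ be a surjective linear map with kernel L. Then the array (π(v₁),…,π(v₅)) belongs to 𝒜 and satisfies m ≠ 0; that is, it lies in 𝒜 ∖ 𝒜₀. -/

import Mathlib

/-- The quadruple `(p,q,x,y)` satisfies the CAT(0) (2+2) comparison with respect to the
distance function `d`. -/
def Cat0Quad {X : Type*} (d : X → X → ℝ) (p q x y : X) : Prop :=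
  ∃ p' q' x' y' : EuclideanSpace ℝ (Fin 2),
    dist x' y' = d x y ∧
    dist p' x' = d p x ∧ dist p' y' = d p y ∧
    dist q' x' = d q x ∧ dist q' y' = d q y ∧
    ((y' 0 - x' 0) * (p' 1 - x' 1) - (y' 1 - x' 1) * (p' 0 - x' 0)) *
      ((y' 0 - x' 0) * (q' 1 - x' 1) - (y' 1 - x' 1) * (q' 0 - x' 0)) ≤ 0 ∧
    ∀ z ∈ segment ℝ x' y', d p q ≤ dist p' z + dist z q'

/-- A metric space satisfies the CAT(0) comparison if every quadruple of its points,
in every labeling, satisfies the CAT(0) (2+2) comparison. -/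
def Cat0Comparison (X : Type*) [MetricSpace X] : Prop :=
  ∀ p q x y : X, Cat0Quad (fun a b => dist a b) p q x y

/-- The vertices of the standard simplex in `ℝⁿ`: `stdVert n i` for `i < n` is the
`i`-th standard basis vector, and `stdVert n n = 0`. -/
noncomputable def stdVert (n : ℕ) (i : Fin (n + 1)) : EuclideanSpace ℝ (Fin n) :=
  if h : (i : ℕ) < n then EuclideanSpace.single ⟨i, h⟩ 1 else 0


/-- Orientation sign of the `i`-th facet. -/
noncomputable def facetSign (y : Fin 5 → EuclideanSpace ℝ (Fin 3)) (i : Fin 5) : ℝ :=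
  Real.sign ((-1 : ℝ) ^ ((i : ℕ) + 1) *
    Matrix.det (Matrix.of fun a b : Fin 3 =>
      (y (Fin.succAbove i b.succ) - y (Fin.succAbove i 0)) a))

def MemA (y : Fin 5 → EuclideanSpace ℝ (Fin 3)) : Prop :=
  ¬ Coplanar ℝ (Set.range y) ∧
    ∀ i j k : Fin 5, i ≠ j → j ≠ k → i ≠ k →
      ¬ Collinear ℝ ({y i, y j, y k} : Set (EuclideanSpace ℝ (Fin 3)))

noncomputable def nPlus (y : Fin 5 → EuclideanSpace ℝ (Fin 3)) : ℕ :=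
  Nat.card {i : Fin 5 // facetSign y i = 1}

noncomputable def nMinus (y : Fin 5 → EuclideanSpace ℝ (Fin 3)) : ℕ :=
  Nat.card {i : Fin 5 // facetSign y i = -1}

noncomputable def nZero (y : Fin 5 → EuclideanSpace ℝ (Fin 3)) : ℕ :=
  Nat.card {i : Fin 5 // facetSign y i = 0}

noncomputable def mVal (y : Fin 5 → EuclideanSpace ℝ (Fin 3)) : ℤ :=
  (nMinus y : ℤ) - (nPlus y : ℤ)

/-- Expansion of a quadratic form at a balanced combination of four points. -/
theorem quadraticForm_balanced_apply {V : Type*} [AddCommGroup V] [Module ℝ V]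
    (W : QuadraticForm ℝ V) (p q x y : V) {α β γ δ : ℝ} (h : α + β = γ + δ) :
    W (α • p + β • q - γ • x - δ • y) =
      α * γ * W (p - x) + α * δ * W (p - y) + β * γ * W (q - x) + β * δ * W (q - y)
        - α * β * W (p - q) - γ * δ * W (x - y) := by
  have key : ∀ v, W v = QuadraticMap.associated (R := ℝ) W v v := fun v =>
    (QuadraticMap.associated_eq_self_apply ℝ W v).symm
  have symm : ∀ v w, QuadraticMap.associated (R := ℝ) W v w =
      QuadraticMap.associated (R := ℝ) W w v := fun v w => by
    simp only [QuadraticMap.associated_apply, add_comm v w]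
    congr 1
    abel
  obtain rfl : α = γ + δ - β := by linarith
  simp only [key, map_add, map_sub, map_smul, LinearMap.add_apply, LinearMap.sub_apply,
    LinearMap.smul_apply, smul_eq_mul, symm q p, symm x p, symm y p, symm x q, symm y q, symm y x]
  ring

/-- Stewart's theorem, in the form of a weighted sum of squared distances. -/
theorem dist_sq_affine_combination {E : Type*} [NormedAddCommGroup E] [InnerProductSpace ℝ E]
    (p x y : E) {γ δ : ℝ} (h : γ + δ = 1) :
    dist p (γ • x + δ • y) ^ 2 =
      γ * dist p x ^ 2 + δ * dist p y ^ 2 - γ * δ * dist x y ^ 2 := by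
  have e1 : p - (γ • x + δ • y) = γ • (p - x) + δ • (p - y) := by
    obtain rfl : γ = 1 - δ := by linarith
    module
  have e2 : x - y = (p - y) - (p - x) := by abel
  rw [dist_eq_norm, dist_eq_norm, dist_eq_norm, dist_eq_norm, e1, e2, norm_add_sq_real,
    norm_sub_sq_real (p - y) (p - x), norm_smul, norm_smul, inner_smul_left, inner_smul_right,
    real_inner_comm (p - y) (p - x), mul_pow, mul_pow, Real.norm_eq_abs, Real.norm_eq_abs,
    sq_abs, sq_abs]
  simp only [conj_trivial]
  obtain rfl : γ = 1 - δ := by linarith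
  ring

theorem Cat0Quad.weighted_nonneg {X : Type*} {d : X → X → ℝ} {p q x y : X}
    (h : Cat0Quad d p q x y) (hd : 0 ≤ d p q) {α β γ δ : ℝ} (hα : 0 ≤ α) (hβ : 0 ≤ β)
    (hγ : 0 ≤ γ) (hδ : 0 ≤ δ) (hs : α + β = γ + δ) :
    0 ≤ α * γ * d p x ^ 2 + α * δ * d p y ^ 2 + β * γ * d q x ^ 2 + β * δ * d q y ^ 2
        - α * β * d p q ^ 2 - γ * δ * d x y ^ 2 := by
  obtain ⟨p', q', x', y', hxy, hpx, hpy, hqx, hqy, -, hz⟩ := h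
  rw [← hxy, ← hpx, ← hpy, ← hqx, ← hqy]
  rcases (add_nonneg hγ hδ).eq_or_lt with h0 | hpos
  · obtain rfl : α = 0 := by linarith
    obtain rfl : β = 0 := by linarith
    obtain rfl : γ = 0 := by linarith
    simp
  set s := γ + δ with hsdef
  have hs1 : γ / s + δ / s = 1 := by rw [← add_div, div_self hpos.ne']
  set z := (γ / s) • x' + (δ / s) • y'
  have hle := hz z ⟨γ / s, δ / s, by positivity, by positivity, hs1, rfl⟩
  have hp := dist_sq_affine_combination p' x' y' hs1
  have hq := dist_sq_affine_combination q' x' y' hs1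
  rw [dist_comm z q'] at hle
  change dist p' z ^ 2 = _ at hp
  change dist q' z ^ 2 = _ at hq
  have hp' : s ^ 2 * dist p' z ^ 2 = s * γ * dist p' x' ^ 2 + s * δ * dist p' y' ^ 2
      - γ * δ * dist x' y' ^ 2 := by rw [hp]; field_simp
  have hq' : s ^ 2 * dist q' z ^ 2 = s * γ * dist q' x' ^ 2 + s * δ * dist q' y' ^ 2
      - γ * δ * dist x' y' ^ 2 := by rw [hq]; field_simp
  have hsq : α * β * d p q ^ 2 ≤ α * β * (dist p' z + dist q' z) ^ 2 := by gcongr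
  have hsβ : s = α + β := hs.symm
  have hmain : 0 ≤ s * α * dist p' z ^ 2 + s * β * dist q' z ^ 2 - α * β * d p q ^ 2 := by
    rw [hsβ]
    nlinarith [sq_nonneg (α * dist p' z - β * dist q' z)]
  have hfin : s * (s * α * dist p' z ^ 2 + s * β * dist q' z ^ 2 - α * β * d p q ^ 2) =
      s * (α * γ * dist p' x' ^ 2 + α * δ * dist p' y' ^ 2 + β * γ * dist q' x' ^ 2
        + β * δ * dist q' y' ^ 2 - α * β * d p q ^ 2 - γ * δ * dist x' y' ^ 2) := by
    linear_combination α * hp' + β * hq' - γ * δ * dist x' y' ^ 2 * hs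
  rwa [mul_left_cancel₀ hpos.ne' hfin] at hmain

/-- In a `CAT(0)` configuration, a form realizing the squared distances is nonnegative on balanced
combinations of the vertices having at most two positive and at most two negative weights. -/
theorem Cat0Comparison.quadraticForm_nonneg {X : Type*} [MetricSpace X] (hX : Cat0Comparison X)
    {V : Type*} [AddCommGroup V] [Module ℝ V] (W : QuadraticForm ℝ V)
    (x : Fin 5 → X) (v : Fin 5 → V) (hW : ∀ i j, W (v i - v j) = dist (x i) (x j) ^ 2)
    (a : Fin 5 → ℝ) (ha : ∑ i, a i = 0) (hpos : (Finset.univ.filter fun i => 0 < a i).card ≤ 2)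
    (hneg : (Finset.univ.filter fun i => a i < 0).card ≤ 2) :
    0 ≤ W (∑ i, a i • v i) := by
  obtain ⟨S, hS, hSc⟩ := Finset.exists_superset_card_eq hpos (by simp)
  obtain ⟨T, hT, hTc⟩ := Finset.exists_superset_card_eq hneg (by simp)
  obtain ⟨p, q, hpq, rfl⟩ := Finset.card_eq_two.1 hSc
  obtain ⟨r, t, hrt, rfl⟩ := Finset.card_eq_two.1 hTc
  have hS0 : ∀ i ∉ ({p, q} : Finset (Fin 5)), max (a i) 0 = 0 := fun i hi =>
    max_eq_right (not_lt.1 fun h => hi (hS (by simpa using h)))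
  have hT0 : ∀ i ∉ ({r, t} : Finset (Fin 5)), max (-a i) 0 = 0 := fun i hi =>
    max_eq_right (not_lt.1 fun h => hi (hT (by simpa using h)))
  have hsplit : ∀ i, a i = max (a i) 0 - max (-a i) 0 := fun i =>
    (max_zero_sub_max_neg_zero_eq_self (a i)).symm
  have hsum : ∑ i, a i • v i = max (a p) 0 • v p + max (a q) 0 • v q
      - max (-a r) 0 • v r - max (-a t) 0 • v t := by
    rw [sub_sub, ← Finset.sum_pair (f := fun i => max (a i) 0 • v i) hpq,
      ← Finset.sum_pair (f := fun i => max (-a i) 0 • v i) hrt,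
      Finset.sum_subset (Finset.subset_univ {p, q}) fun i _ hi => by simp only [hS0 i hi, zero_smul],
      Finset.sum_subset (Finset.subset_univ {r, t}) fun i _ hi => by simp only [hT0 i hi, zero_smul],
      ← Finset.sum_sub_distrib]
    exact Finset.sum_congr rfl fun i _ => by rw [← sub_smul, ← hsplit]
  have hbal : max (a p) 0 + max (a q) 0 = max (-a r) 0 + max (-a t) 0 := by
    rw [← sub_eq_zero, ← Finset.sum_pair (f := fun i => max (a i) 0) hpq,
      ← Finset.sum_pair (f := fun i => max (-a i) 0) hrt,
      Finset.sum_subset (Finset.subset_univ {p, q}) fun i _ hi => hS0 i hi,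
      Finset.sum_subset (Finset.subset_univ {r, t}) fun i _ hi => hT0 i hi,
      ← Finset.sum_sub_distrib]
    exact (Finset.sum_congr rfl fun i _ => (hsplit i).symm).trans ha
  rw [hsum, quadraticForm_balanced_apply W _ _ _ _ hbal]
  simp only [hW]
  exact (hX (x p) (x q) (x r) (x t)).weighted_nonneg dist_nonneg (le_max_right _ _)
    (le_max_right _ _) (le_max_right _ _) (le_max_right _ _) hbal

theorem stdVert_castSucc (n : ℕ) (i : Fin n) :
    stdVert n i.castSucc = EuclideanSpace.single i 1 := by
  simp [stdVert]

theorem stdVert_last (n : ℕ) : stdVert n (Fin.last n) = 0 := by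
  simp [stdVert]

theorem eq_zero_of_sum_smul_stdVert_eq_zero {n : ℕ} (a : Fin (n + 1) → ℝ) (ha : ∑ i, a i = 0)
    (h : ∑ i, a i • stdVert n i = 0) : a = 0 := by
  rw [Fin.sum_univ_castSucc] at h ha
  simp only [stdVert_castSucc, stdVert_last, smul_zero, add_zero] at h
  have hc : ∀ i : Fin n, a i.castSucc = 0 := fun i => by
    simpa [Finset.sum_apply, Pi.single_apply] using
      congrArg (fun u : EuclideanSpace ℝ (Fin n) => u i) h
  simp only [hc, Finset.sum_const_zero, zero_add] at ha
  funext i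
  induction i using Fin.lastCases with
  | last => exact ha
  | cast i => exact hc i

/-- The signed volume whose sign is `facetSign`. -/
noncomputable def facetVolume (y : Fin 5 → EuclideanSpace ℝ (Fin 3)) (i : Fin 5) : ℝ :=
  (-1 : ℝ) ^ ((i : ℕ) + 1) *
    Matrix.det (Matrix.of fun a b : Fin 3 =>
      (y (Fin.succAbove i b.succ) - y (Fin.succAbove i 0)) a)

theorem facetSign_eq (y : Fin 5 → EuclideanSpace ℝ (Fin 3)) (i : Fin 5) :
    facetSign y i = Real.sign (facetVolume y i) := rfl

theorem facetSign_eq_one_iff (y : Fin 5 → EuclideanSpace ℝ (Fin 3)) (i : Fin 5) :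
    facetSign y i = 1 ↔ 0 < facetVolume y i := by
  rw [facetSign_eq]
  rcases lt_trichotomy (facetVolume y i) 0 with h | h | h
  · rw [Real.sign_of_neg h]; constructor <;> intro <;> linarith
  · simp [h]
  · simp [Real.sign_of_pos h, h]

theorem facetSign_eq_neg_one_iff (y : Fin 5 → EuclideanSpace ℝ (Fin 3)) (i : Fin 5) :
    facetSign y i = -1 ↔ facetVolume y i < 0 := by
  rw [facetSign_eq]
  rcases lt_trichotomy (facetVolume y i) 0 with h | h | h
  · simp [Real.sign_of_neg h, h]
  · simp [h]
  · rw [Real.sign_of_pos h]; constructor <;> intro <;> linarith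

theorem facetVolume_eq (y : Fin 5 → EuclideanSpace ℝ (Fin 3)) (i : Fin 5)
    (j : Fin 4 → Fin 5) (hj : i.succAbove = j) :
    facetVolume y i = (-1 : ℝ) ^ ((i : ℕ) + 1) *
      Matrix.det (Matrix.of fun a b : Fin 3 => (y (j b.succ) a - y (j 0) a)) := by
  subst hj; rfl

theorem facetVolume_zero (y : Fin 5 → EuclideanSpace ℝ (Fin 3)) :
    facetVolume y 0 = -Matrix.det (Matrix.of fun a b : Fin 3 => y (![2, 3, 4] b) a - y 1 a) := by
  rw [facetVolume_eq y 0 ![1, 2, 3, 4] (by decide)]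
  simp [Matrix.det_fin_three]

theorem facetVolume_one (y : Fin 5 → EuclideanSpace ℝ (Fin 3)) :
    facetVolume y 1 = Matrix.det (Matrix.of fun a b : Fin 3 => y (![2, 3, 4] b) a - y 0 a) := by
  rw [facetVolume_eq y 1 ![0, 2, 3, 4] (by decide)]
  simp [Matrix.det_fin_three]

theorem facetVolume_two (y : Fin 5 → EuclideanSpace ℝ (Fin 3)) :
    facetVolume y 2 = -Matrix.det (Matrix.of fun a b : Fin 3 => y (![1, 3, 4] b) a - y 0 a) := by
  rw [facetVolume_eq y 2 ![0, 1, 3, 4] (by decide)]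
  norm_num [Matrix.det_fin_three]

theorem facetVolume_three (y : Fin 5 → EuclideanSpace ℝ (Fin 3)) :
    facetVolume y 3 = Matrix.det (Matrix.of fun a b : Fin 3 => y (![1, 2, 4] b) a - y 0 a) := by
  rw [facetVolume_eq y 3 ![0, 1, 2, 4] (by decide)]
  norm_num [Matrix.det_fin_three]

theorem facetVolume_four (y : Fin 5 → EuclideanSpace ℝ (Fin 3)) :
    facetVolume y 4 = -Matrix.det (Matrix.of fun a b : Fin 3 => y (![1, 2, 3] b) a - y 0 a) := by
  rw [facetVolume_eq y 4 ![0, 1, 2, 3] (by decide)]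
  norm_num [Matrix.det_fin_three]

theorem sum_facetVolume (y : Fin 5 → EuclideanSpace ℝ (Fin 3)) : ∑ i, facetVolume y i = 0 := by
  simp only [Fin.sum_univ_five, facetVolume_zero, facetVolume_one, facetVolume_two,
    facetVolume_three, facetVolume_four, Matrix.det_fin_three, Matrix.of_apply]
  simp
  ring

theorem sum_facetVolume_smul (y : Fin 5 → EuclideanSpace ℝ (Fin 3)) :
    ∑ i, facetVolume y i • y i = 0 := by
  ext a
  simp only [Fin.sum_univ_five, facetVolume_zero, facetVolume_one, facetVolume_two,
    facetVolume_three, facetVolume_four, Matrix.det_fin_three, Matrix.of_apply]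
  fin_cases a <;> simp <;> ring

/-- If all facets are degenerate, the points do not affinely span the space. -/
theorem facetVolume_ne_zero {f : EuclideanSpace ℝ (Fin 4) →ₗ[ℝ] EuclideanSpace ℝ (Fin 3)}
    (hf : Function.Surjective f) : facetVolume (fun i => f (stdVert 4 i)) ≠ 0 := by
  intro h0
  obtain ⟨s, hs⟩ : ∃ s : Fin 3 → EuclideanSpace ℝ (Fin 4),
      ∀ b, f (s b) = EuclideanSpace.single b 1 := by
    choose s hs using fun b : Fin 3 => hf (EuclideanSpace.single b 1)
    exact ⟨s, hs⟩
  set y : Fin 5 → EuclideanSpace ℝ (Fin 3) := fun i => f (stdVert 4 i)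
  have hy4 : y 4 = 0 := by
    change f (stdVert 4 (Fin.last 4)) = 0
    rw [stdVert_last, map_zero]
  have hexp : ∀ u : EuclideanSpace ℝ (Fin 4),
      f u = u 0 • y 0 + u 1 • y 1 + u 2 • y 2 + u 3 • y 3 := fun u => by
    have hu : u = ∑ i : Fin 4, u i • stdVert 4 i.castSucc := by
      ext j
      simp [stdVert_castSucc, Pi.single_apply]
    conv_lhs => rw [hu]
    rw [map_sum, Fin.sum_univ_four]
    simp only [map_smul]
    rfl
  have hone : Matrix.det (Matrix.of fun a b : Fin 3 =>
      s b 0 * y 0 a + s b 1 * y 1 a + s b 2 * y 2 a + s b 3 * y 3 a) = 1 := by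
    rw [← Matrix.det_one (n := Fin 3) (R := ℝ)]
    congr 1
    ext a b
    have := congrArg (fun u : EuclideanSpace ℝ (Fin 3) => u a) ((hexp (s b)).symm.trans (hs b))
    simpa [Matrix.one_apply, Pi.single_apply] using this
  have h1 := congrFun h0 0
  have h2 := congrFun h0 1
  have h3 := congrFun h0 2
  have h4 := congrFun h0 3
  rw [facetVolume_zero] at h1
  rw [facetVolume_one] at h2
  rw [facetVolume_two] at h3
  rw [facetVolume_three] at h4
  simp only [Matrix.det_fin_three, Matrix.of_apply, Matrix.cons_val, hy4, PiLp.zero_apply,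
    Pi.zero_apply, zero_sub] at h1 h2 h3 h4 hone
  let M : Fin 4 → Fin 4 → Fin 4 → ℝ := fun i j k =>
    s 0 i * (s 1 j * s 2 k - s 1 k * s 2 j) - s 0 j * (s 1 i * s 2 k - s 1 k * s 2 i)
      + s 0 k * (s 1 i * s 2 j - s 1 j * s 2 i)
  refine zero_ne_one (α := ℝ) ?_
  rw [← hone]
  linear_combination -M 1 2 3 * h1 + M 0 2 3 * h2 - M 0 1 3 * h3 + M 0 1 2 * h4

theorem not_coplanar_range_of_surjective
    {f : EuclideanSpace ℝ (Fin 4) →ₗ[ℝ] EuclideanSpace ℝ (Fin 3)}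
    (hf : Function.Surjective f) : ¬ Coplanar ℝ (Set.range fun i => f (stdVert 4 i)) := by
  intro h
  have htop : vectorSpan ℝ (Set.range fun i => f (stdVert 4 i)) = ⊤ := by
    rw [eq_top_iff]
    rintro w -
    obtain ⟨u, rfl⟩ := hf w
    have hu : u = ∑ i : Fin 4, u i • stdVert 4 i.castSucc := by
      ext j
      simp [stdVert_castSucc, Pi.single_apply]
    rw [hu, map_sum]
    refine Submodule.sum_mem _ fun i _ => ?_
    rw [map_smul]
    refine Submodule.smul_mem _ _ ?_
    have := vsub_mem_vectorSpan ℝ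
      (Set.mem_range_self (f := fun i => f (stdVert 4 i)) i.castSucc)
      (Set.mem_range_self (f := fun i => f (stdVert 4 i)) (Fin.last 4))
    rwa [stdVert_last, map_zero, vsub_eq_sub, sub_zero] at this
  rw [Coplanar, htop, rank_top, ← Module.finrank_eq_rank, finrank_euclideanSpace_fin] at h
  norm_num at h

/-- Three collinear points satisfy a nontrivial affine relation. -/
theorem Collinear.exists_affine_relation {V : Type*} [AddCommGroup V] [Module ℝ V] {p q r : V}
    (h : Collinear ℝ ({p, q, r} : Set V)) :
    ∃ b c : ℝ, (b ≠ 0 ∨ c ≠ 0) ∧ (-b - c) • p + b • q + c • r = 0 := by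
  obtain ⟨v, hv⟩ := (collinear_iff_of_mem (p₀ := p) (by simp)).1 h
  obtain ⟨s, hs⟩ := hv q (by simp)
  obtain ⟨t, ht⟩ := hv r (by simp)
  simp only [vadd_eq_add] at hs ht
  by_cases h0 : s = 0
  · refine ⟨1, 0, by simp, ?_⟩
    rw [hs, h0]
    module
  · refine ⟨t, -s, by simp [h0], ?_⟩
    rw [hs, ht]
    module

theorem not_collinear_of_quadraticForm_neg {X : Type*} [MetricSpace X]
    (hX : Cat0Comparison X) (x : Fin 5 → X)
    (W : QuadraticForm ℝ (EuclideanSpace ℝ (Fin 4)))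
    (hW : ∀ i j, W (stdVert 4 i - stdVert 4 j) = dist (x i) (x j) ^ 2)
    {F : Type*} [AddCommGroup F] [Module ℝ F] (f : EuclideanSpace ℝ (Fin 4) →ₗ[ℝ] F)
    (hf : ∀ v ∈ LinearMap.ker f, v ≠ 0 → W v < 0) {i j k : Fin 5}
    (hij : i ≠ j) (hjk : j ≠ k) (hik : i ≠ k) :
    ¬ Collinear ℝ ({f (stdVert 4 i), f (stdVert 4 j), f (stdVert 4 k)} : Set F) := by
  intro h
  obtain ⟨b, c, hbc, hrel⟩ := h.exists_affine_relation
  let a : Fin 5 → ℝ := Pi.single i (-b - c) + Pi.single j b + Pi.single k c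
  have hai : a i = -b - c := by simp [a, hij, hik]
  have haj : a j = b := by simp [a, hij.symm, hjk]
  have hak : a k = c := by simp [a, hik.symm, hjk.symm]
  have ha0 : ∀ t, t ≠ i → t ≠ j → t ≠ k → a t = 0 := fun t h1 h2 h3 => by simp [a, h1, h2, h3]
  have hasum : ∑ t, a t = 0 := by
    simp [a, Finset.sum_add_distrib]
    ring
  have hacomb : ∑ t, a t • stdVert 4 t =
      (-b - c) • stdVert 4 i + b • stdVert 4 j + c • stdVert 4 k := by
    simp [a, Finset.sum_add_distrib, add_smul, Pi.single_apply, ite_smul]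
  have hsupp : ∀ t, a t ≠ 0 → t = i ∨ t = j ∨ t = k := fun t ht => by
    by_contra! hc
    exact ht (ha0 t hc.1 hc.2.1 hc.2.2)
  have hcard : ∀ S : Finset (Fin 5), (∀ t ∈ S, a t ≠ 0) →
      (∃ t ∈ ({i, j, k} : Finset (Fin 5)), t ∉ S) → S.card ≤ 2 := fun S hS ⟨t, ht, htS⟩ => by
    have hsub : S ⊆ ({i, j, k} : Finset (Fin 5)).erase t := fun r hr => by
      refine Finset.mem_erase.2 ⟨fun h => htS (h ▸ hr), ?_⟩
      simpa using hsupp r (hS r hr)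
    have := Finset.card_le_card hsub
    rwa [Finset.card_erase_of_mem ht, Finset.card_eq_three.2 ⟨i, j, k, hij, hik, hjk, rfl⟩] at this
  have hnonneg := hX.quadraticForm_nonneg W x (stdVert 4) hW a hasum
    (hcard _ (fun t ht => (by simpa using ht : 0 < a t).ne') (by
      by_contra! hc
      simp only [Finset.mem_insert, Finset.mem_singleton, forall_eq_or_imp, forall_eq,
        Finset.mem_filter, Finset.mem_univ, true_and, hai, haj, hak] at hc
      linarith))
    (hcard _ (fun t ht => (by simpa using ht : a t < 0).ne) (by
      by_contra! hc
      simp only [Finset.mem_insert, Finset.mem_singleton, forall_eq_or_imp, forall_eq,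
        Finset.mem_filter, Finset.mem_univ, true_and, hai, haj, hak] at hc
      linarith))
  refine (hf _ ?_ fun h0 => ?_).not_ge hnonneg
  · rw [LinearMap.mem_ker, hacomb]
    simpa using hrel
  · have := eq_zero_of_sum_smul_stdVert_eq_zero a hasum h0
    rcases hbc with hb | hc
    · exact hb (by rw [← haj, this, Pi.zero_apply])
    · exact hc (by rw [← hak, this, Pi.zero_apply])

theorem mVal_ne_zero_of_quadraticForm_neg {X : Type*} [MetricSpace X]
    (hX : Cat0Comparison X) (x : Fin 5 → X)
    (W : QuadraticForm ℝ (EuclideanSpace ℝ (Fin 4)))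
    (hW : ∀ i j, W (stdVert 4 i - stdVert 4 j) = dist (x i) (x j) ^ 2)
    (f : EuclideanSpace ℝ (Fin 4) →ₗ[ℝ] EuclideanSpace ℝ (Fin 3)) (hsurj : Function.Surjective f)
    (hf : ∀ v ∈ LinearMap.ker f, v ≠ 0 → W v < 0) :
    mVal (fun i => f (stdVert 4 i)) ≠ 0 := by
  intro hm
  set y : Fin 5 → EuclideanSpace ℝ (Fin 3) := fun i => f (stdVert 4 i)
  have hP : nPlus y = (Finset.univ.filter fun i => 0 < facetVolume y i).card := by
    simp only [nPlus, facetSign_eq_one_iff]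
    rw [Nat.card_eq_fintype_card, Fintype.card_subtype]
  have hN : nMinus y = (Finset.univ.filter fun i => facetVolume y i < 0).card := by
    simp only [nMinus, facetSign_eq_neg_one_iff]
    rw [Nat.card_eq_fintype_card, Fintype.card_subtype]
  have hdisj : Disjoint (Finset.univ.filter fun i => 0 < facetVolume y i)
      (Finset.univ.filter fun i => facetVolume y i < 0) :=
    Finset.disjoint_filter.2 fun i _ h => h.le.not_gt
  have htotal := Finset.card_le_univ
    ((Finset.univ.filter fun i => 0 < facetVolume y i).disjUnion _ hdisj)
  rw [Finset.card_disjUnion, Fintype.card_fin] at htotal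
  rw [mVal, hP, hN] at hm
  have hnonneg := hX.quadraticForm_nonneg W x (stdVert 4) hW (facetVolume y) (sum_facetVolume y)
    (by omega) (by omega)
  refine (hf _ ?_ fun h0 => ?_).not_ge hnonneg
  · rw [LinearMap.mem_ker, map_sum]
    simpa only [map_smul] using sum_facetVolume_smul y
  · exact facetVolume_ne_zero hsurj
      (eq_zero_of_sum_smul_stdVert_eq_zero _ (sum_facetVolume y) h0)

/-- Let `x₁, …, x₅` be points in a metric space satisfying the CAT(0) comparison, with
associated quadratic form `W` on `ℝ⁴`.  Let `L` be a 1-dimensional subspace with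
`W v < 0` for all nonzero `v ∈ L`, and `π : ℝ⁴ → ℝ³` a surjective linear map with
kernel `L`.  Then the projected array of simplex vertices belongs to `𝒜` and has
`m ≠ 0`; that is, it lies in `𝒜 ∖ 𝒜₀`. -/
theorem projected_vertices_in_A_minus_A0 {X : Type*} [MetricSpace X]
    (hX : Cat0Comparison X) (x : Fin 5 → X)
    (W : QuadraticForm ℝ (EuclideanSpace ℝ (Fin 4)))
    (hW : ∀ i j, W (stdVert 4 i - stdVert 4 j) = dist (x i) (x j) ^ 2)
    (L : Submodule ℝ (EuclideanSpace ℝ (Fin 4)))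
    (hdim : Module.finrank ℝ L = 1)
    (hL : ∀ v ∈ L, v ≠ 0 → W v < 0)
    (π : EuclideanSpace ℝ (Fin 4) →ₗ[ℝ] EuclideanSpace ℝ (Fin 3))
    (hsurj : Function.Surjective π) (hker : LinearMap.ker π = L) :
    MemA (fun i => π (stdVert 4 i)) ∧ mVal (fun i => π (stdVert 4 i)) ≠ 0 := by
  subst hker
  exact ⟨⟨not_coplanar_range_of_surjective hsurj, fun _ _ _ hij hjk hik =>
    not_collinear_of_quadraticForm_neg hX x W hW π hL hij hjk hik⟩,
    mVal_ne_zero_of_quadraticForm_neg hX x W hW π hsurj hL⟩
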